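/- For every q, x, y, ρ ∈ ℝ and every integer n ≥ 0: h_n(x|q) = Σ_{j=0}^{n} [n choose j]_q · p_j(x|y,ρ,q) · ρ^{n−j} · h_{n−j}(y|q). -/

import Mathlib

open Finset

section Defs

variable {K : Type*} [Field K]

/-- q-Pochhammer symbol `(a; q)_n = ∏_{j=0}^{n-1} (1 - a q^j)`. -/
def qPoch (a q : K) (n : ℕ) : K := ∏ j ∈ Finset.range n, (1 - a * q ^ j)

/-- Gaussian (q-binomial) coefficient `[n choose k]_q`. -/
def qBinom (q : K) : ℕ → ℕ → K
  | _, 0 => 1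
  | 0, _ + 1 => 0
  | n + 1, k + 1 => qBinom q n k + q ^ (k + 1) * qBinom q n (k + 1)

/-- Continuous q-Hermite polynomials `h_n(x|q)`:
`h_{-1} = 0`, `h_0 = 1`, `h_{n+1} = 2x h_n - (1 - q^n) h_{n-1}`. -/
def hQH (q x : K) : ℕ → K
  | 0 => 1
  | 1 => 2 * x
  | n + 2 => 2 * x * hQH q x (n + 1) - (1 - q ^ (n + 1)) * hQH q x n

/-- The polynomials `b_n(x|q) = (-1)^n q^{n(n-1)/2} h_n(x|q^{-1})` (for `q ≠ 0`). -/
def bQH (q x : K) (n : ℕ) : K := (-1) ^ n * q ^ (n * (n - 1) / 2) * hQH q⁻¹ x n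

/-- Al-Salam–Chihara polynomials in conjugate-pair parametrization `p_n(x|y,ρ,q)`:
`p_{-1} = 0`, `p_0 = 1`,
`p_{n+1} = 2(x - ρ y q^n) p_n - (1 - q^n)(1 - ρ² q^{n-1}) p_{n-1}`. -/
def pASC (q x y ρ : K) : ℕ → K
  | 0 => 1
  | 1 => 2 * (x - ρ * y)
  | n + 2 => 2 * (x - ρ * y * q ^ (n + 1)) * pASC q x y ρ (n + 1)
      - (1 - q ^ (n + 1)) * (1 - ρ ^ 2 * q ^ n) * pASC q x y ρ n

open Classical in
/-- The polynomials `g_n(x|y,ρ,q)`: `ρ^n p_n(y|x,ρ⁻¹,q)` for `ρ ≠ 0`, `b_n(x|q)` for `ρ = 0`. -/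
noncomputable def gASC (q x y ρ : K) (n : ℕ) : K :=
  if ρ = 0 then bQH q x n else ρ ^ n * pASC q y x ρ⁻¹ n

/-- `ω(u,v|ρ) = (1-ρ²)² - 4uvρ(1+ρ²) + 4ρ²(u²+v²)`. -/
def omegaW (u v ρ : K) : K :=
  (1 - ρ ^ 2) ^ 2 - 4 * u * v * ρ * (1 + ρ ^ 2) + 4 * ρ ^ 2 * (u ^ 2 + v ^ 2)

/-- `v(x|t) = 1 - 2xt + t²`. -/
def vQH (x t : K) : K := 1 - 2 * x * t + t ^ 2

/-- Coefficient `e_n(a,b,c,d,q)` of the Askey–Wilson three-term recurrence. -/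
def eAW (a b c d q : K) (n : ℕ) : K :=
  q ^ ((n : ℤ) - 2) /
      ((1 - a * b * c * d * q ^ (2 * (n : ℤ) - 2)) * (1 - a * b * c * d * q ^ (2 * (n : ℤ)))) *
    ((a + b + c + d) * (q ^ 2 - a * b * c * d * q ^ (n : ℤ) * (1 + q - q ^ ((n : ℤ) + 1))) +
      (a * b * c + a * b * d + a * c * d + b * c * d) *
        (q - q ^ ((n : ℤ) + 2) - q ^ ((n : ℤ) + 1) + a * b * c * d * q ^ (2 * (n : ℤ))))

/-- Coefficient `f_n(a,b,c,d,q)` of the Askey–Wilson three-term recurrence. -/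
def fAW (a b c d q : K) (n : ℕ) : K :=
  (1 - q ^ (n : ℤ)) * (1 - a * b * q ^ ((n : ℤ) - 1)) * (1 - a * c * q ^ ((n : ℤ) - 1)) *
      (1 - a * d * q ^ ((n : ℤ) - 1)) * (1 - b * c * q ^ ((n : ℤ) - 1)) *
      (1 - b * d * q ^ ((n : ℤ) - 1)) * (1 - c * d * q ^ ((n : ℤ) - 1)) *
      (1 - a * b * c * d * q ^ ((n : ℤ) - 2)) /
    (qPoch (a * b * c * d * q ^ (2 * (n : ℤ) - 3)) q 3 *
      (1 - a * b * c * d * q ^ (2 * (n : ℤ) - 2)))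

/-- Monic Askey–Wilson polynomials `α_n(x|a,b,c,d,q)`:
`α_{-1} = 0`, `α_0 = 1`, `α_{n+1} = (2x - e_n) α_n - f_n α_{n-1}`. -/
def alphaAW (a b c d q x : K) : ℕ → K
  | 0 => 1
  | 1 => 2 * x - eAW a b c d q 0
  | n + 2 => (2 * x - eAW a b c d q (n + 1)) * alphaAW a b c d q x (n + 1) -
      fAW a b c d q (n + 1) * alphaAW a b c d q x n

/-- Coefficient of `ψ_n` in the continuous dual Hahn recurrence:
`q^n (b+c+d) + bcd q^{n-1} (1 - q^{n+1} - q^n)`. -/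
def ePsi (b c d q : K) (n : ℕ) : K :=
  q ^ (n : ℤ) * (b + c + d) + b * c * d * q ^ ((n : ℤ) - 1) * (1 - q ^ ((n : ℤ) + 1) - q ^ (n : ℤ))

/-- Coefficient of `ψ_{n-1}` in the continuous dual Hahn recurrence:
`(1-q^n)(1-bcq^{n-1})(1-bdq^{n-1})(1-cdq^{n-1})`. -/
def fPsi (b c d q : K) (n : ℕ) : K :=
  (1 - q ^ (n : ℤ)) * (1 - b * c * q ^ ((n : ℤ) - 1)) * (1 - b * d * q ^ ((n : ℤ) - 1)) *
    (1 - c * d * q ^ ((n : ℤ) - 1))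

/-- Continuous dual Hahn polynomials `ψ_n(x|b,c,d,q)`:
`ψ_{-1} = 0`, `ψ_0 = 1`, `ψ_{n+1} = (2x - ePsi_n) ψ_n - fPsi_n ψ_{n-1}`. -/
def psiCDH (b c d q x : K) : ℕ → K
  | 0 => 1
  | 1 => 2 * x - ePsi b c d q 0
  | n + 2 => (2 * x - ePsi b c d q (n + 1)) * psiCDH b c d q x (n + 1) -
      fPsi b c d q (n + 1) * psiCDH b c d q x n

/-- Al-Salam–Chihara polynomials `Q_n(x|c,d,q)`:
`Q_{-1} = 0`, `Q_0 = 1`, `Q_{n+1} = (2x - q^n(c+d)) Q_n - (1-q^n)(1-cdq^{n-1}) Q_{n-1}`. -/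
def qASC (c d q x : K) : ℕ → K
  | 0 => 1
  | 1 => 2 * x - (c + d)
  | n + 2 => (2 * x - q ^ (n + 1) * (c + d)) * qASC c d q x (n + 1) -
      (1 - q ^ (n + 1)) * (1 - c * d * q ^ n) * qASC c d q x n

/-- Coefficient `ẽ_n` of the conjugate-pair Askey–Wilson recurrence. -/
def eW (y ρ₁ z ρ₂ q : K) (n : ℕ) : K :=
  2 * q ^ ((n : ℤ) - 1) /
      ((1 - ρ₁ ^ 2 * ρ₂ ^ 2 * q ^ (2 * (n : ℤ) - 2)) *
        (1 - ρ₁ ^ 2 * ρ₂ ^ 2 * q ^ (2 * (n : ℤ)))) *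
    (q * (ρ₁ * y + ρ₂ * z) *
        (1 - ρ₁ ^ 2 * ρ₂ ^ 2 * q ^ ((n : ℤ) - 2) * (1 + q - q ^ ((n : ℤ) + 1))) +
      ρ₁ * ρ₂ * (ρ₁ * z + ρ₂ * y) *
        (1 - q ^ ((n : ℤ) + 1) - q ^ (n : ℤ) + ρ₁ ^ 2 * ρ₂ ^ 2 * q ^ (2 * (n : ℤ) - 1)))

/-- Coefficient `f̃_n` of the conjugate-pair Askey–Wilson recurrence. -/
def fW (y ρ₁ z ρ₂ q : K) (n : ℕ) : K :=
  (1 - q ^ (n : ℤ)) * omegaW y z (ρ₁ * ρ₂ * q ^ ((n : ℤ) - 1)) *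
      (1 - ρ₁ ^ 2 * q ^ ((n : ℤ) - 1)) * (1 - ρ₂ ^ 2 * q ^ ((n : ℤ) - 1)) *
      (1 - ρ₁ ^ 2 * ρ₂ ^ 2 * q ^ ((n : ℤ) - 2)) /
    (qPoch (ρ₁ ^ 2 * ρ₂ ^ 2 * q ^ (2 * (n : ℤ) - 3)) q 3 *
      (1 - ρ₁ ^ 2 * ρ₂ ^ 2 * q ^ (2 * (n : ℤ) - 2)))

/-- Conjugate-pair Askey–Wilson polynomials `w_n(x|y,ρ₁,z,ρ₂,q)`:
`w_{-1} = 0`, `w_0 = 1`, `w_{n+1} = (2x - ẽ_n) w_n - f̃_n w_{n-1}`. -/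
def wAW (x y ρ₁ z ρ₂ q : K) : ℕ → K
  | 0 => 1
  | 1 => 2 * x - eW y ρ₁ z ρ₂ q 0
  | n + 2 => (2 * x - eW y ρ₁ z ρ₂ q (n + 1)) * wAW x y ρ₁ z ρ₂ q (n + 1) -
      fW y ρ₁ z ρ₂ q (n + 1) * wAW x y ρ₁ z ρ₂ q n

/-- Chebyshev polynomials of the second kind. -/
def chebU (x : K) : ℕ → K
  | 0 => 1
  | 1 => 2 * x
  | n + 2 => 2 * x * chebU x (n + 1) - chebU x n

/-- The quantity `A_n` from the Askey–Wilson recurrence factorization. -/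
def A_AW (a b c d q : K) (n : ℕ) : K :=
  (1 - a * b * q ^ (n : ℤ)) * (1 - a * c * q ^ (n : ℤ)) * (1 - a * d * q ^ (n : ℤ)) *
      (1 - a * b * c * d * q ^ ((n : ℤ) - 1)) /
    (a * (1 - a * b * c * d * q ^ (2 * (n : ℤ) - 1)) * (1 - a * b * c * d * q ^ (2 * (n : ℤ))))

/-- The quantity `C_n` from the Askey–Wilson recurrence factorization. -/
def C_AW (a b c d q : K) (n : ℕ) : K :=
  a * (1 - q ^ (n : ℤ)) * (1 - b * c * q ^ ((n : ℤ) - 1)) * (1 - b * d * q ^ ((n : ℤ) - 1)) *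
      (1 - c * d * q ^ ((n : ℤ) - 1)) /
    ((1 - a * b * c * d * q ^ (2 * (n : ℤ) - 2)) * (1 - a * b * c * d * q ^ (2 * (n : ℤ) - 1)))

end Defs

section QBinom

variable {K : Type*} [Field K]

theorem qBinom_zero_right (q : K) (n : ℕ) : qBinom q n 0 = 1 := by
  cases n <;> rfl

theorem qBinom_succ_succ (q : K) (n k : ℕ) :
    qBinom q (n + 1) (k + 1) = qBinom q n k + q ^ (k + 1) * qBinom q n (k + 1) := rfl

theorem qBinom_eq_zero_of_lt (q : K) {n k : ℕ} (h : n < k) : qBinom q n k = 0 := by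
  induction n generalizing k with
  | zero =>
    obtain ⟨k, rfl⟩ := Nat.exists_eq_succ_of_ne_zero h.ne'
    rfl
  | succ n ih =>
    obtain ⟨k, rfl⟩ := Nat.exists_eq_succ_of_ne_zero (Nat.ne_zero_of_lt h)
    rw [Nat.succ_eq_add_one, qBinom_succ_succ, ih (by omega), ih (by omega)]
    ring

theorem qBinom_self (q : K) (n : ℕ) : qBinom q n n = 1 := by
  induction n with
  | zero => rfl
  | succ n ih => rw [qBinom_succ_succ, ih, qBinom_eq_zero_of_lt q n.lt_succ_self]; ring

theorem one_sub_pow_mul_qBinom_succ_right (q : K) (j m : ℕ) :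
    (1 - q ^ (j + 1)) * qBinom q (j + m) (j + 1) = (1 - q ^ m) * qBinom q (j + m) j := by
  induction j generalizing m with
  | zero =>
    induction m with
    | zero => simp [qBinom_eq_zero_of_lt]
    | succ m ih =>
      rw [← add_assoc, qBinom_succ_succ]
      simp only [qBinom_zero_right] at ih ⊢
      linear_combination q * ih
  | succ i ihi =>
    induction m with
    | zero => simp [qBinom_eq_zero_of_lt]
    | succ m ih =>
      have h := ihi (m + 1)
      rw [show i + (m + 1) = i + 1 + m by ring] at h
      rw [← add_assoc, qBinom_succ_succ, qBinom_succ_succ]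
      linear_combination q ^ (i + 2) * ih + h

/-- Absorption identity for the Gaussian coefficients. -/
theorem one_sub_pow_mul_qBinom_succ_succ (q : K) (j m : ℕ) :
    (1 - q ^ (j + 1)) * qBinom q (j + m + 1) (j + 1) =
      (1 - q ^ (j + m + 1)) * qBinom q (j + m) j := by
  rw [qBinom_succ_succ]
  linear_combination q ^ (j + 1) * one_sub_pow_mul_qBinom_succ_right q j m

theorem one_sub_pow_mul_qBinom_succ_left (q : K) (j m : ℕ) :
    (1 - q ^ (m + 1)) * qBinom q (j + m + 1) j =
      (1 - q ^ (j + m + 1)) * qBinom q (j + m) j := by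
  rw [← one_sub_pow_mul_qBinom_succ_succ, add_assoc, one_sub_pow_mul_qBinom_succ_right]

end QBinom

section Expansion

variable {K : Type*} [Field K]

theorem hQH_add_two (q x : K) (n : ℕ) :
    hQH q x (n + 2) = 2 * x * hQH q x (n + 1) - (1 - q ^ (n + 1)) * hQH q x n := rfl

theorem pASC_add_two (q x y ρ : K) (n : ℕ) :
    pASC q x y ρ (n + 2) = 2 * (x - ρ * y * q ^ (n + 1)) * pASC q x y ρ (n + 1)
      - (1 - q ^ (n + 1)) * (1 - ρ ^ 2 * q ^ n) * pASC q x y ρ n := rfl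

/-- The `j`-th term in the expansion of `h_n(x|q)` in Al-Salam–Chihara polynomials. -/
def ascTerm (q x y ρ : K) (n j : ℕ) : K :=
  qBinom q n j * pASC q x y ρ j * ρ ^ (n - j) * hQH q y (n - j)

/-- The q-Hermite recurrence applied termwise to the Al-Salam–Chihara expansion telescopes. -/
theorem sum_ascTerm_recurrence (q x y ρ : K) (n N : ℕ) (hN : N ≤ n) :
    ∑ j ∈ Finset.range (N + 1), (ascTerm q x y ρ (n + 2) j - 2 * x * ascTerm q x y ρ (n + 1) j
        + (1 - q ^ (n + 1)) * ascTerm q x y ρ n j) =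
      qBinom q (n + 1) (N + 1) * (1 - q ^ (N + 1)) * (1 - ρ ^ 2 * q ^ N) * ρ ^ (n - N) *
          hQH q y (n - N) * pASC q x y ρ N
        - qBinom q (n + 1) N * ρ ^ (n + 1 - N) * hQH q y (n + 1 - N) * pASC q x y ρ (N + 1) := by
  induction N with
  | zero =>
    have h := one_sub_pow_mul_qBinom_succ_succ q 0 n
    simp only [zero_add, qBinom_zero_right] at h
    simp only [ascTerm, zero_add, Finset.sum_range_one, qBinom_zero_right, Nat.sub_zero,
      hQH_add_two, pASC]
    linear_combination -(1 - ρ ^ 2) * ρ ^ n * hQH q y n * h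
  | succ N ih =>
    rw [Finset.sum_range_succ, ih (by omega)]
    obtain ⟨m, rfl⟩ := Nat.exists_eq_add_of_le hN
    have h₁ := one_sub_pow_mul_qBinom_succ_succ q (N + 1) m
    have h₂ := one_sub_pow_mul_qBinom_succ_left q (N + 1) m
    simp only [ascTerm, show N + 1 + m - N = m + 1 by omega,
      show N + 1 + m + 1 - N = m + 2 by omega, show N + 1 + m - (N + 1) = m by omega,
      show N + 1 + m + 1 - (N + 1) = m + 1 by omega,
      show N + 1 + m + 2 - (N + 1) = m + 2 by omega, pASC_add_two, hQH_add_two]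
    rw [show N + 1 + m + 2 = N + 1 + m + 1 + 1 by ring, qBinom_succ_succ q (N + 1 + m + 1) N]
    linear_combination
      -(1 - ρ ^ 2 * q ^ (N + 1)) * ρ ^ m * hQH q y m * pASC q x y ρ (N + 1) * h₁
        - ρ ^ 2 * q ^ (N + 1) * ρ ^ m * hQH q y m * pASC q x y ρ (N + 1) * h₂

theorem sum_ascTerm_add_two (q x y ρ : K) (n : ℕ) :
    ∑ j ∈ Finset.range (n + 3), ascTerm q x y ρ (n + 2) j =
      2 * x * ∑ j ∈ Finset.range (n + 2), ascTerm q x y ρ (n + 1) j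
        - (1 - q ^ (n + 1)) * ∑ j ∈ Finset.range (n + 1), ascTerm q x y ρ n j := by
  have h := sum_ascTerm_recurrence q x y ρ n n le_rfl
  rw [Finset.sum_add_distrib, Finset.sum_sub_distrib, ← Finset.mul_sum, ← Finset.mul_sum] at h
  rw [Finset.sum_range_succ, Finset.sum_range_succ, Finset.sum_range_succ _ (n + 1)]
  have e₁ : ascTerm q x y ρ (n + 2) (n + 2) = pASC q x y ρ (n + 2) := by
    simp [ascTerm, qBinom_self, hQH]
  have e₂ : ascTerm q x y ρ (n + 1) (n + 1) = pASC q x y ρ (n + 1) := by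
    simp [ascTerm, qBinom_self, hQH]
  have e₃ : ascTerm q x y ρ (n + 2) (n + 1) =
      (qBinom q (n + 1) n + q ^ (n + 1)) * pASC q x y ρ (n + 1) * ρ * (2 * y) := by
    simp [ascTerm, qBinom_succ_succ q (n + 1) n, qBinom_self, hQH,
      show n + 2 - (n + 1) = 1 by omega]
  simp only [qBinom_self, Nat.sub_self, show n + 1 - n = 1 by omega, hQH, pow_zero, pow_one] at h
  rw [e₁, e₂, e₃, pASC_add_two]
  linear_combination h

theorem hQH_eq_sum_ascTerm (q x y ρ : K) (n : ℕ) :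
    hQH q x n = ∑ j ∈ Finset.range (n + 1), ascTerm q x y ρ n j := by
  induction n using Nat.twoStepInduction with
  | zero => simp [ascTerm, hQH, pASC, qBinom_self]
  | one =>
    simp only [ascTerm, Finset.sum_range_succ, Finset.sum_range_zero, qBinom_zero_right,
      qBinom_self, Nat.sub_zero, Nat.sub_self, hQH, pASC]
    ring
  | more n ih₀ ih₁ => rw [hQH_add_two, sum_ascTerm_add_two, ih₀, ih₁]

end Expansion

/-- Lemma: `h_n(x|q) = ∑_{j=0}^n [n choose j]_q p_j(x|y,ρ,q) ρ^{n-j} h_{n-j}(y|q)`. -/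
theorem hQH_expansion_in_pASC (q x y ρ : ℝ) (n : ℕ) :
    hQH q x n =
      ∑ j ∈ Finset.range (n + 1),
        qBinom q n j * pASC q x y ρ j * ρ ^ (n - j) * hQH q y (n - j) :=
  hQH_eq_sum_ascTerm q x y ρ n
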